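/- arXiv:2312.06513 — 2 statements merged into one kernel-verified Lean document; each statement's English description precedes it below -/
import Mathlib

section
/- Let a ≥ 1 and n ≥ 1 be integers. The Pak–Stanley labeling, sending each valid m-acyclic weight function w of the extended Shi arrangement 𝒜^{a,a+1}_{n−1} to its label (f(1),…,f(n)), is a bijection from the set of valid m-acyclic weight functions onto the set of a-parking functions of length n. -/
/-- Cyclically consecutive pairs along a list of vertices. -/
def cpairs {n : ℕ} (c : List (Fin n)) : List (Fin n × Fin n) := c.zip (c.rotate 1)

/-- `c` is a directed cycle of the weighted digraph `w`, an edge `u → v`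
being present when `w u v ≠ ⊥` (`⊥` stands for `-∞`). -/
def IsCycle {n : ℕ} (w : Fin n → Fin n → WithBot ℤ) (c : List (Fin n)) : Prop :=
  2 ≤ c.length ∧ c.Nodup ∧ ∀ p ∈ cpairs c, w p.1 p.2 ≠ ⊥

/-- Total weight of the edges of a cycle. -/
def cycWeight {n : ℕ} (w : Fin n → Fin n → WithBot ℤ) (c : List (Fin n)) : WithBot ℤ :=
  ((cpairs c).map fun p => w p.1 p.2).sum

/-- An `m`-ascending cycle: a directed cycle of nonnegative total weight. -/
def MAscending {n : ℕ} (w : Fin n → Fin n → WithBot ℤ) (c : List (Fin n)) : Prop :=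
  IsCycle w c ∧ 0 ≤ cycWeight w c

/-- A weighted digraph is `m`-acyclic if it has no `m`-ascending cycle. -/
def MAcyclic {n : ℕ} (w : Fin n → Fin n → WithBot ℤ) : Prop :=
  ∀ c : List (Fin n), ¬ MAscending w c

/-- `w` is a valid weight function of the contiguous integral deformation of
the braid arrangement determined by the bounds `a = α` and `b = β`:
`w i j ∈ {α i j, …, β i j} ∪ {⊥}`, `w i j = ⊥ ↔ w j i = β j i`, and
`w j i = -1 - w i j` whenever both values are finite.  There are no loops. -/
def ValidW {n : ℕ} (a b : Fin n → Fin n → ℤ) (w : Fin n → Fin n → WithBot ℤ) : Prop :=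
  (∀ i, w i i = ⊥) ∧
  ∀ i j : Fin n, i ≠ j →
    (w i j ≠ ⊥ → (a i j : WithBot ℤ) ≤ w i j ∧ w i j ≤ (b i j : WithBot ℤ)) ∧
    (w i j = ⊥ ↔ w j i = (b j i : WithBot ℤ)) ∧
    (∀ x y : ℤ, w i j = (x : WithBot ℤ) → w j i = (y : WithBot ℤ) → y = -1 - x)

/-- Lower bounds of the extended Shi arrangement `A^{a,a+1}_{n-1}`:
`α(i,j) = 1 - a` for `i < j`, extended by `α(j,i) = -β(i,j) = -a`. -/
def shiAlpha {n : ℕ} (a : ℤ) (u v : Fin n) : ℤ := if u < v then 1 - a else -a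

/-- Upper bounds of the extended Shi arrangement `A^{a,a+1}_{n-1}`:
`β(i,j) = a` for `i < j`, extended by `β(j,i) = -α(i,j) = a - 1`. -/
def shiBeta {n : ℕ} (a : ℤ) (u v : Fin n) : ℤ := if u < v then a else a - 1

/-- `f` is the Pak–Stanley label of the weight function `w` with order of
gains `σ`:  `f i` is the sum of the weights `w i j` over the `j` succeeding
`i` in `σ` (the separations), plus the number of such `j` with `j < i`
(the inversions). -/
def IsPSLabel {n : ℕ} (σ : Equiv.Perm (Fin n)) (w : Fin n → Fin n → WithBot ℤ)
    (f : Fin n → ℤ) : Prop :=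
  ∀ i : Fin n, (f i : WithBot ℤ) =
    (∑ j ∈ Finset.univ.filter fun j => σ.symm i < σ.symm j, w i j)
      + (((Finset.univ.filter fun j => σ.symm i < σ.symm j ∧ j < i).card : ℤ) : WithBot ℤ)

/-- `f` is an `a`-parking function: it consists of nonnegative integers and
its weakly increasing rearrangement `f̃` satisfies `f̃ i ≤ a * i`
(`0`-indexed), i.e. `f̃(i) ≤ a (i - 1)` in `1`-indexed notation. -/
def IsAPark {n : ℕ} (a : ℤ) (f : Fin n → ℤ) : Prop :=
  (∀ i, 0 ≤ f i) ∧
  ∃ τ : Equiv.Perm (Fin n), Monotone (f ∘ τ) ∧ ∀ i : Fin n, f (τ i) ≤ a * (i : ℤ)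

/-- The gain of `w` as an integer, the value `⊥` being read as one less than the lower bound. -/
def gain {n : ℕ} (a : ℤ) (w : Fin n → Fin n → WithBot ℤ) (i j : Fin n) : ℤ :=
  (w i j).unbotD (shiAlpha a i j - 1)

/-- The axioms satisfied by the integer gains of a valid `m`-acyclic weight function. -/
structure IsGain {n : ℕ} (a : ℤ) (D : Fin n → Fin n → ℤ) : Prop where
  diag : ∀ i, D i i < 0
  symm : ∀ i j, i ≠ j → D j i = -1 - D i j
  lower : ∀ i j, i ≠ j → shiAlpha a i j - 1 ≤ D i j
  upper : ∀ i j, i ≠ j → D i j ≤ shiBeta a i j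
  trans : ∀ i j l, i ≠ j → j ≠ l → i ≠ l → ∀ k m : ℤ, shiAlpha a i j ≤ k → k ≤ D i j →
    shiAlpha a j l ≤ m → m ≤ D j l → shiAlpha a i l ≤ k + m → k + m ≤ shiBeta a i l →
    k + m ≤ D i l

/-- The Pak–Stanley label in terms of integer gains. -/
def gainLabel {n : ℕ} (D : Fin n → Fin n → ℤ) (i : Fin n) : ℤ :=
  ∑ j, if 0 ≤ D i j then D i j + (if j < i then 1 else 0) else 0

theorem gain_cases {n : ℕ} (a : ℤ) (w : Fin n → Fin n → WithBot ℤ) (i j : Fin n) :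
    (w i j = ⊥ ∧ gain a w i j = shiAlpha a i j - 1) ∨ w i j = ((gain a w i j : ℤ) : WithBot ℤ) := by
  unfold gain
  cases h : w i j with
  | bot => left; simp
  | coe x => right; simp

theorem eq_coe_gain {n : ℕ} {a : ℤ} {w : Fin n → Fin n → WithBot ℤ} {i j : Fin n}
    (h : shiAlpha a i j ≤ gain a w i j) : w i j = ((gain a w i j : ℤ) : WithBot ℤ) := by
  rcases gain_cases a w i j with h' | h'
  · omega
  · exact h'

theorem shiAlpha_eq {n : ℕ} (a : ℤ) {i j : Fin n} (h : i ≠ j) :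
    shiAlpha a i j = -shiBeta a j i := by
  unfold shiAlpha shiBeta
  rcases lt_or_gt_of_ne h with h | h
  · rw [if_pos h, if_neg h.not_gt]; ring
  · rw [if_neg h.not_gt, if_pos h]

theorem shi_bounds {n : ℕ} {a : ℤ} (i j : Fin n) :
    -a ≤ shiAlpha a i j ∧ shiAlpha a i j ≤ 1 - a ∧ a - 1 ≤ shiBeta a i j ∧
      shiBeta a i j ≤ a := by
  unfold shiAlpha shiBeta
  split_ifs <;> omega

theorem cycle_three {n : ℕ} {w : Fin n → Fin n → WithBot ℤ} (hw : MAcyclic w)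
    {i j l : Fin n} (hij : i ≠ j) (hjl : j ≠ l) (hil : i ≠ l) {p q r : ℤ}
    (h1 : w i j = p) (h2 : w j l = q) (h3 : w l i = r) : p + q + r < 0 := by
  by_contra! h
  apply hw [i, j, l]
  refine ⟨⟨by simp, by simp [hij, hjl, hil], ?_⟩, ?_⟩
  · simp [cpairs, h1, h2, h3]
  · simp only [cycWeight, cpairs, List.rotate_cons_succ, List.rotate_zero, List.cons_append,
      List.nil_append, List.zip_cons_cons, List.zip_nil_right, List.map_cons, List.map_nil,
      List.sum_cons, List.sum_nil, h1, h2, h3, add_zero]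
    have : 0 ≤ p + (q + r) := by omega
    exact_mod_cast this

theorem valid_gain {n : ℕ} {a : ℤ} (ha : 1 ≤ a) {w : Fin n → Fin n → WithBot ℤ}
    (hv : ValidW (shiAlpha a) (shiBeta a) w) (hw : MAcyclic w) : IsGain a (gain a w) := by
  have hsymm : ∀ i j, i ≠ j → gain a w j i = -1 - gain a w i j := by
    intro i j hij
    have e1 := shiAlpha_eq a hij
    have e2 := shiAlpha_eq a hij.symm
    obtain ⟨-, h2, h3⟩ := hv.2 i j hij
    obtain ⟨-, h2', -⟩ := hv.2 j i hij.symm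
    rcases gain_cases a w i j with ⟨hb, hg⟩ | hg
    · have := h2.1 hb
      have hg' : gain a w j i = shiBeta a j i := by simp [gain, this]
      omega
    · rcases gain_cases a w j i with ⟨hb, hg'⟩ | hg'
      · have := h2'.1 hb
        rw [this] at hg
        have := WithBot.coe_inj.1 hg
        omega
      · exact h3 _ _ hg hg'
  have hlow : ∀ i j, i ≠ j → shiAlpha a i j - 1 ≤ gain a w i j := by
    intro i j hij
    rcases gain_cases a w i j with ⟨hb, hg⟩ | hg
    · omega
    · have := ((hv.2 i j hij).1 (by simp [hg])).1
      rw [hg] at this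
      have := WithBot.coe_le_coe.1 this
      omega
  have hup : ∀ i j, i ≠ j → gain a w i j ≤ shiBeta a i j := by
    intro i j hij
    have := hlow j i hij.symm
    have := hsymm i j hij
    have := shiAlpha_eq a hij.symm
    omega
  refine ⟨?_, hsymm, hlow, hup, ?_⟩
  · intro i
    have := shi_bounds (a := a) i i
    simp only [gain, hv.1 i, WithBot.unbotD_bot]
    omega
  · intro i j l hij hjl hil k m hk1 hk2 hm1 hm2 hs1 hs2
    by_contra! hlt
    have e1 := hsymm i l hil
    have e2 := shiAlpha_eq a hil.symm
    have := cycle_three hw hij hjl hil (eq_coe_gain (a := a) (by omega))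
      (eq_coe_gain (a := a) (by omega)) (eq_coe_gain (a := a) (by omega))
    omega

theorem gain_injective {n : ℕ} {a : ℤ} {w w' : Fin n → Fin n → WithBot ℤ}
    (hv : ValidW (shiAlpha a) (shiBeta a) w) (hv' : ValidW (shiAlpha a) (shiBeta a) w')
    (h : ∀ i j, i ≠ j → gain a w i j = gain a w' i j) : w = w' := by
  have key : ∀ w : Fin n → Fin n → WithBot ℤ, ValidW (shiAlpha a) (shiBeta a) w →
      ∀ i j, i ≠ j → w i j = if gain a w i j < shiAlpha a i j then ⊥ else
        ((gain a w i j : ℤ) : WithBot ℤ) := by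
    intro w hv i j hij
    rcases gain_cases a w i j with ⟨hb, hg⟩ | hg
    · rw [if_pos (by omega), hb]
    · have := ((hv.2 i j hij).1 (by simp [hg])).1
      rw [hg] at this
      have := WithBot.coe_le_coe.1 this
      rw [if_neg (by omega), ← hg]
  funext i j
  by_cases hij : i = j
  · rw [hij, hv.1, hv'.1]
  · rw [key w hv i j hij, key w' hv' i j hij, h i j hij]

theorem isPSLabel_gainLabel {n : ℕ} {a : ℤ} {w : Fin n → Fin n → WithBot ℤ}
    (hD : IsGain a (gain a w)) (σ : Equiv.Perm (Fin n))
    (hσ : ∀ i j : Fin n, i < j → 0 ≤ w (σ i) (σ j)) : IsPSLabel σ w (gainLabel (gain a w)) := by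
  have hpos : ∀ i j, σ.symm i < σ.symm j →
      w i j = ((gain a w i j : ℤ) : WithBot ℤ) ∧ 0 ≤ gain a w i j := by
    intro i j hij
    have h := hσ _ _ hij
    simp only [Equiv.apply_symm_apply] at h
    rcases gain_cases a w i j with ⟨hb, hg⟩ | hg
    · rw [hb] at h
      simp at h
    · refine ⟨hg, ?_⟩
      rw [hg] at h
      exact_mod_cast h
  have hiff : ∀ i j, 0 ≤ gain a w i j ↔ σ.symm i < σ.symm j := by
    intro i j
    refine ⟨fun h => ?_, fun h => (hpos i j h).2⟩
    by_contra hn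
    rcases eq_or_lt_of_le (not_lt.1 hn) with he | hl
    · have := σ.symm.injective he
      subst this
      exact absurd (hD.diag j) (by omega)
    · have h1 := (hpos _ _ hl).2
      have hne : i ≠ j := by rintro rfl; exact lt_irrefl _ hl
      have := hD.symm i j hne
      omega
  intro i
  have hsum : (∑ j ∈ Finset.univ.filter fun j => σ.symm i < σ.symm j, w i j) =
      ((∑ j ∈ Finset.univ.filter fun j => σ.symm i < σ.symm j, gain a w i j : ℤ) :
        WithBot ℤ) := by
    rw [WithBot.coe_sum]
    refine Finset.sum_congr rfl fun j hj => ?_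
    exact (hpos i j (Finset.mem_filter.1 hj).2).1
  rw [hsum, ← WithBot.coe_add]
  congr 1
  unfold gainLabel
  rw [← Finset.filter_filter, Finset.card_filter]
  push_cast
  rw [← Finset.sum_add_distrib, Finset.sum_filter]
  refine Finset.sum_congr rfl fun j _ => ?_
  simp only [hiff]

theorem IsGain.ne {n : ℕ} {a : ℤ} {D : Fin n → Fin n → ℤ} (hD : IsGain a D) {i j : Fin n}
    (h : 0 ≤ D i j) : i ≠ j := by
  rintro rfl
  exact absurd (hD.diag i) (by omega)

theorem IsGain.nonneg_trans {n : ℕ} {a : ℤ} (ha : 1 ≤ a) {D : Fin n → Fin n → ℤ}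
    (hD : IsGain a D) {i j l : Fin n} (h1 : 0 ≤ D i j) (h2 : 0 ≤ D j l) : 0 ≤ D i l := by
  have hij := hD.ne h1
  have hjl := hD.ne h2
  have hil : i ≠ l := by
    rintro rfl
    have := hD.symm i j hij
    omega
  have b1 := shi_bounds (a := a) i j
  have b2 := shi_bounds (a := a) j l
  have b3 := shi_bounds (a := a) i l
  simpa using hD.trans i j l hij hjl hil 0 0 (by omega) h1 (by omega) h2 (by omega) (by omega)

theorem IsGain.term_bounds {n : ℕ} {a : ℤ} {D : Fin n → Fin n → ℤ}
    (hD : IsGain a D) {i j : Fin n} (h : 0 ≤ D i j) :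
    0 ≤ D i j + (if j < i then 1 else 0) ∧ D i j + (if j < i then 1 else 0) ≤ a := by
  have hij := hD.ne h
  have := hD.upper i j hij
  unfold shiBeta at this
  rcases lt_or_gt_of_ne hij with h' | h'
  · rw [if_pos h'] at this
    rw [if_neg h'.not_gt]
    omega
  · rw [if_neg h'.not_gt] at this
    rw [if_pos h']
    omega

theorem gainLabel_le {n : ℕ} {a : ℤ} {D : Fin n → Fin n → ℤ} (hD : IsGain a D) (i : Fin n) :
    gainLabel D i ≤ a * ((Finset.univ.filter fun j => 0 ≤ D i j).card : ℤ) := by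
  unfold gainLabel
  rw [← Finset.sum_filter, mul_comm, ← nsmul_eq_mul]
  exact Finset.sum_le_card_nsmul _ _ _ fun j hj => (hD.term_bounds (Finset.mem_filter.1 hj).2).2

theorem isAPark_gainLabel {n : ℕ} {a : ℤ} (ha : 1 ≤ a) {D : Fin n → Fin n → ℤ}
    (hD : IsGain a D) : IsAPark a (gainLabel D) := by
  refine ⟨fun i => Finset.sum_nonneg fun j _ => ?_, Tuple.sort _, Tuple.monotone_sort _, ?_⟩
  · split_ifs with h h' <;> omega
  · intro i
    by_contra! hlt
    set r : Fin n → ℕ := fun i => (Finset.univ.filter fun j => 0 ≤ D i j).card with hr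
    have hmono : ∀ i j, 0 ≤ D i j → r j < r i := by
      intro i j hij
      apply Finset.card_lt_card
      rw [Finset.ssubset_iff_of_subset]
      · refine ⟨j, by simpa using hij, ?_⟩
        simpa using hD.diag j
      · intro l hl
        simp only [Finset.mem_filter, Finset.mem_univ, true_and] at hl ⊢
        exact hD.nonneg_trans ha hij hl
    have hinj : Function.Injective r := by
      intro i j hij
      by_contra hne
      have := hD.symm i j hne
      rcases le_or_gt 0 (D i j) with h | h
      · have := hmono _ _ h; omega
      · have := hmono j i (by omega); omega
    have hrn : ∀ i, r i < n := by
      intro i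
      have : r i < (Finset.univ : Finset (Fin n)).card := by
        apply Finset.card_lt_card
        rw [Finset.ssubset_iff_of_subset (Finset.subset_univ _)]
        exact ⟨i, Finset.mem_univ _, by simpa using hD.diag i⟩
      simpa using this
    have hcard : (Finset.Ici i).card ≤ (Finset.Ico ((i : ℕ) + 1) n).card := by
      apply Finset.card_le_card_of_injOn fun j => r (Tuple.sort (gainLabel D) j)
      · intro j hj
        have hj' : i ≤ j := by simpa using hj
        have h1 := Tuple.monotone_sort (gainLabel D) hj'
        have h2 := gainLabel_le hD (Tuple.sort (gainLabel D) j)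
        simp only [Function.comp] at h1
        have h3 : a * (i : ℤ) < a * (r (Tuple.sort (gainLabel D) j) : ℤ) := by
          simp only [hr]; omega
        have h4 := lt_of_mul_lt_mul_left h3 (by omega)
        have := hrn (Tuple.sort (gainLabel D) j)
        simp only [Finset.coe_Ico, Set.mem_Ico]
        omega
      · intro j _ j' _ h
        exact (Tuple.sort (gainLabel D)).injective (hinj h)
    simp only [Fin.card_Ici, Nat.card_Ico] at hcard
    have := i.2
    omega

/-- The gains of a vertex over a common initial segment `P` are comparable. -/
theorem IsGain.gains_comparable {n : ℕ} {a : ℤ} {D D' : Fin n → Fin n → ℤ}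
    (hD : IsGain a D) (hD' : IsGain a D') {P : Finset (Fin n)}
    (hP : ∀ p ∈ P, ∀ q ∈ P, p ≠ q → D p q = D' p q) {u p : Fin n} (hu : u ∉ P) (hp : p ∈ P)
    (hpos : ∀ q ∈ P, 0 ≤ D u q) (hpos' : ∀ q ∈ P, 0 ≤ D' u q)
    (hlt : D u p < D' u p) {q : Fin n} (hq : q ∈ P) : D u q ≤ D' u q := by
  by_cases hqp : q = p
  · subst hqp; omega
  have hup : u ≠ p := by rintro rfl; exact hu hp
  have huq : u ≠ q := by rintro rfl; exact hu hq
  rcases (hpos q hq).eq_or_lt with h0 | h0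
  · rw [← h0]; exact hpos' q hq
  have b1 := shi_bounds (a := a) u p
  have b2 := shi_bounds (a := a) p u
  have b3 := shi_bounds (a := a) u q
  have b4 := shi_bounds (a := a) p q
  have s1 := hD.symm u p hup
  have e1 := shiAlpha_eq a hup.symm
  have u1 := hD'.upper u p hup
  have u2 := hD.upper u q huq
  have p0 := hpos p hp
  have t1 := hD.trans p u q hup.symm huq (Ne.symm hqp) (-D' u p) (D u q) (by omega) (by omega)
    (by omega) le_rfl (by omega) (by omega)
  rw [hP p hp q hq (Ne.symm hqp)] at t1
  have t2 := hD'.trans u p q hup (Ne.symm hqp) huq (D' u p) (-D' u p + D u q) (by omega) le_rfl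
    (by omega) t1 (by omega) (by omega)
  omega

/-- The contribution to the label of `u` of the vertices in `P`. -/
def partialLabel {n : ℕ} (D : Fin n → Fin n → ℤ) (P : Finset (Fin n)) (u : Fin n) : ℤ :=
  ∑ p ∈ P, (D u p + (if p < u then 1 else 0))

theorem gainLabel_eq_partial {n : ℕ} {D : Fin n → Fin n → ℤ} {P : Finset (Fin n)} {u : Fin n}
    (hpos : ∀ q ∈ P, 0 ≤ D u q) (hneg : ∀ q ∉ P, D u q < 0) :
    gainLabel D u = partialLabel D P u := by
  unfold gainLabel partialLabel
  rw [← Finset.sum_filter]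
  refine Finset.sum_congr ?_ fun _ _ => rfl
  ext q
  simp only [Finset.mem_filter, Finset.mem_univ, true_and]
  refine ⟨fun h => ?_, hpos q⟩
  by_contra hq
  have := hneg q hq
  omega

theorem IsGain.partial_le_gainLabel {n : ℕ} {a : ℤ} {D : Fin n → Fin n → ℤ} (hD : IsGain a D)
    {P : Finset (Fin n)} {u : Fin n} (hpos : ∀ q ∈ P, 0 ≤ D u q) :
    partialLabel D P u ≤ gainLabel D u := by
  unfold gainLabel partialLabel
  rw [← Finset.sum_filter]
  apply Finset.sum_le_sum_of_subset_of_nonneg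
  · intro q hq
    simpa using hpos q hq
  · intro q hq _
    exact (hD.term_bounds (Finset.mem_filter.1 hq).2).1

theorem partialLabel_lt {n : ℕ} {D D' : Fin n → Fin n → ℤ} {P : Finset (Fin n)} {u p : Fin n}
    (hle : ∀ q ∈ P, D u q ≤ D' u q) (hp : p ∈ P) (hlt : D u p < D' u p) :
    partialLabel D P u < partialLabel D' P u :=
  Finset.sum_lt_sum (fun q hq => by have := hle q hq; omega) ⟨p, hp, by omega⟩

theorem IsGain.exists_lowest {n : ℕ} {a : ℤ} (ha : 1 ≤ a) {D : Fin n → Fin n → ℤ}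
    (hD : IsGain a D) (P : Finset (Fin n)) (hP : P ≠ Finset.univ) :
    ∃ u ∉ P, ∀ q ∉ P, D u q < 0 := by
  have hne : Pᶜ.Nonempty := by
    rw [Finset.nonempty_iff_ne_empty, Ne, Finset.compl_eq_empty_iff]
    exact hP
  obtain ⟨u, hu, hmin⟩ := Finset.exists_min_image Pᶜ
    (fun i => (Finset.univ.filter fun j => 0 ≤ D i j).card) hne
  refine ⟨u, by simpa using hu, fun q hq => ?_⟩
  by_contra! hn
  have := hmin q (by simpa using hq)
  refine absurd this (not_le.2 (Finset.card_lt_card ?_))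
  rw [Finset.ssubset_iff_of_subset]
  · refine ⟨q, by simpa using hn, ?_⟩
    simpa using hD.diag q
  · intro l hl
    simp only [Finset.mem_filter, Finset.mem_univ, true_and] at hl ⊢
    exact hD.nonneg_trans ha hn hl

theorem lowest_not_lt {n : ℕ} {a : ℤ} {D D' : Fin n → Fin n → ℤ}
    (hD : IsGain a D) (hD' : IsGain a D') (hf : gainLabel D = gainLabel D')
    {P : Finset (Fin n)} (hP : ∀ p ∈ P, ∀ q ∈ P, p ≠ q → D p q = D' p q)
    (hl : ∀ p ∈ P, ∀ q ∉ P, 0 ≤ D q p) (hl' : ∀ p ∈ P, ∀ q ∉ P, 0 ≤ D' q p)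
    {u v : Fin n} (hu : u ∉ P) (hv : v ∉ P) (hlow : ∀ q ∉ P, D u q < 0)
    (hlow' : ∀ q ∉ P, D' v q < 0) : ¬ u < v := by
  intro huv
  have hne : u ≠ v := huv.ne
  have hvu : 0 ≤ D v u := by
    have := hD.symm u v hne
    have := hlow v hv
    omega
  have huv' : 0 ≤ D' u v := by
    have := hD'.symm v u hne.symm
    have := hlow' u hu
    omega
  have h1 : partialLabel D P v < partialLabel D' P v := by
    rw [← gainLabel_eq_partial (fun q hq => hl' q hq v hv) hlow', ← hf]
    have h2 := hD.partial_le_gainLabel (P := insert u P) (u := v) (by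
      intro q hq
      rcases Finset.mem_insert.1 hq with rfl | hq
      · exact hvu
      · exact hl q hq v hv)
    have h3 : partialLabel D (insert u P) v = D v u + 1 + partialLabel D P v := by
      unfold partialLabel
      rw [Finset.sum_insert hu, if_pos huv]
    omega
  obtain ⟨p, hp, hlt⟩ : ∃ p ∈ P, D v p < D' v p := by
    by_contra! hcon
    refine absurd h1 (not_lt.2 (Finset.sum_le_sum fun q hq => ?_))
    have := hcon q hq
    omega
  have hvp : v ≠ p := by rintro rfl; exact hv hp
  have hup : u ≠ p := by rintro rfl; exact hu hp
  have b1 := shi_bounds (a := a) v p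
  have b2 := shi_bounds (a := a) u p
  have b3 := shi_bounds (a := a) v u
  have b4 := shi_bounds (a := a) u v
  have hbeta : shiBeta a v p ≤ shiBeta a u p := by
    unfold shiBeta
    split_ifs with c1 c2
    · exact le_rfl
    · exact absurd (huv.trans c1) c2
    · omega
    · exact le_rfl
  have up := hD'.upper v p hvp
  have p0 := hl p hp v hv
  have hu1 : D u p < D' v p := by
    by_contra! hcon
    have := hD.trans v u p hne.symm hup hvp 0 (D' v p) (by omega) hvu (by omega) hcon (by omega)
      (by omega)
    omega
  have hu2 := hD'.trans u v p hne hvp hup 0 (D' v p) (by omega) huv' (by omega) le_rfl (by omega)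
    (by omega)
  have hlt' : D u p < D' u p := by omega
  have h4 := partialLabel_lt (fun q hq => hD.gains_comparable hD' hP hu hp
    (fun q hq => hl q hq u hu) (fun q hq => hl' q hq u hu) hlt' hq) hp hlt'
  have h5 := hD'.partial_le_gainLabel (fun q hq => hl' q hq u hu)
  rw [← hf, gainLabel_eq_partial (fun q hq => hl q hq u hu) hlow] at h5
  omega

theorem gainLabel_injective {n : ℕ} {a : ℤ} (ha : 1 ≤ a) {D D' : Fin n → Fin n → ℤ}
    (hD : IsGain a D) (hD' : IsGain a D') (hf : gainLabel D = gainLabel D') :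
    ∀ i j, i ≠ j → D i j = D' i j := by
  have main : ∀ m ≤ n, ∃ P : Finset (Fin n), P.card = m ∧
      (∀ p ∈ P, ∀ q ∈ P, p ≠ q → D p q = D' p q) ∧
      (∀ p ∈ P, ∀ q ∉ P, 0 ≤ D q p) ∧ (∀ p ∈ P, ∀ q ∉ P, 0 ≤ D' q p) := by
    intro m
    induction m with
    | zero => exact fun _ => ⟨∅, by simp⟩
    | succ m ih =>
      intro hm
      obtain ⟨P, hc, hP, hl, hl'⟩ := ih (by omega)
      have hne : P ≠ Finset.univ := by
        rintro rfl
        simp at hc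
        omega
      obtain ⟨u, hu, hlow⟩ := hD.exists_lowest ha P hne
      obtain ⟨v, hv, hlow'⟩ := hD'.exists_lowest ha P hne
      have huv : u = v := le_antisymm
        (not_lt.1 (lowest_not_lt hD' hD hf.symm
          (fun p hp q hq hpq => (hP p hp q hq hpq).symm) hl' hl hv hu hlow' hlow))
        (not_lt.1 (lowest_not_lt hD hD' hf hP hl hl' hu hv hlow hlow'))
      subst huv
      have hpos : ∀ q ∈ P, 0 ≤ D u q := fun q hq => hl q hq u hu
      have hpos' : ∀ q ∈ P, 0 ≤ D' u q := fun q hq => hl' q hq u hu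
      have hlab : partialLabel D P u = partialLabel D' P u := by
        rw [← gainLabel_eq_partial hpos hlow, ← gainLabel_eq_partial hpos' hlow', hf]
      have heq : ∀ p ∈ P, D u p = D' u p := by
        intro p hp
        rcases lt_trichotomy (D u p) (D' u p) with h | h | h
        · have := partialLabel_lt (fun q hq => hD.gains_comparable hD' hP hu hp hpos hpos' h hq)
            hp h
          omega
        · exact h
        · have := partialLabel_lt (fun q hq => hD'.gains_comparable hD
            (fun p hp q hq hpq => (hP p hp q hq hpq).symm) hu hp hpos' hpos h hq) hp h
          omega
      refine ⟨insert u P, by rw [Finset.card_insert_of_notMem hu, hc], ?_, ?_, ?_⟩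
      · intro p hp q hq hpq
        rcases Finset.mem_insert.1 hp with rfl | hp
        · rcases Finset.mem_insert.1 hq with rfl | hq
          · exact absurd rfl hpq
          · exact heq q hq
        · rcases Finset.mem_insert.1 hq with rfl | hq
          · rw [hD.symm q p hpq.symm, hD'.symm q p hpq.symm, heq p ‹p ∈ P›]
          · exact hP p hp q hq hpq
      · intro p hp q hq
        rw [Finset.mem_insert, not_or] at hq
        rcases Finset.mem_insert.1 hp with rfl | hp
        · have := hD.symm q p hq.1
          have := hlow q hq.2
          omega
        · exact hl p hp q hq.2
      · intro p hp q hq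
        rw [Finset.mem_insert, not_or] at hq
        rcases Finset.mem_insert.1 hp with rfl | hp
        · have := hD'.symm q p hq.1
          have := hlow' q hq.2
          omega
        · exact hl' p hp q hq.2
  obtain ⟨P, hc, hP, -, -⟩ := main n le_rfl
  have : P = Finset.univ := by
    rw [← Finset.card_eq_iff_eq_univ, hc, Fintype.card_fin]
  subst this
  exact fun i j => hP i (Finset.mem_univ _) j (Finset.mem_univ _)

/-- The hyperplanes `x i - x j = k` with `j ∈ S` and `0 ≤ k ≤ a` lying below the height `t`. -/
noncomputable def hits {n : ℕ} (a : ℤ) (S : Finset (Fin n)) (x : Fin n → ℝ) (i : Fin n)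
    (t : ℝ) : Finset (Fin n × ℤ) :=
  (S ×ˢ Finset.Icc 0 a).filter fun p =>
    (if p.1 < i then p.2 < a else 0 < p.2) ∧ x p.1 + p.2 ≤ t

theorem mem_hits {n : ℕ} {a : ℤ} {S : Finset (Fin n)} {x : Fin n → ℝ} {i : Fin n} {t : ℝ}
    {p : Fin n × ℤ} : p ∈ hits a S x i t ↔ (p.1 ∈ S ∧ 0 ≤ p.2 ∧ p.2 ≤ a) ∧
      (if p.1 < i then p.2 < a else 0 < p.2) ∧ x p.1 + p.2 ≤ t := by
  simp [hits]

theorem exists_gt_below {s : Set ℝ} (hs : s.Finite) (e : ℝ) :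
    ∃ t > e, ∀ y ∈ s, e < y → t < y := by
  have h : ∀ᶠ t in nhdsWithin e (Set.Ioi e), ∀ y ∈ s, e < y → t < y := by
    rw [Filter.eventually_all_finite hs]
    intro y _
    by_cases hy : e < y
    · filter_upwards [Ioo_mem_nhdsGT hy] with t ht _
      exact ht.2
    · exact Filter.Eventually.of_forall fun t h => absurd h hy
  obtain ⟨t, h1, h2⟩ := (h.and self_mem_nhdsWithin).exists
  exact ⟨t, h2, h1⟩

theorem card_hits_of_forall_le {n : ℕ} {a : ℤ} (ha : 1 ≤ a) {S : Finset (Fin n)}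
    {x : Fin n → ℝ} {i : Fin n} {t : ℝ}
    (h : ∀ p ∈ S ×ˢ Finset.Icc (0 : ℤ) a, x p.1 + p.2 ≤ t) :
    ((hits a S x i t).card : ℤ) = a * S.card := by
  unfold hits
  rw [Finset.card_filter, Finset.sum_product]
  have : ∀ j ∈ S, (∑ k ∈ Finset.Icc (0 : ℤ) a,
      if (if j < i then k < a else 0 < k) ∧ x j + k ≤ t then 1 else 0) = a.toNat := by
    intro j hj
    rw [← Finset.card_filter]
    have : (Finset.Icc (0 : ℤ) a).filter (fun k =>
        (if j < i then k < a else 0 < k) ∧ x j + k ≤ t) =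
        if j < i then Finset.Ico 0 a else Finset.Ioc 0 a := by
      ext k
      have := h (j, k)
      simp only [Finset.mem_product, Finset.mem_Icc] at this
      split_ifs <;> simp only [Finset.mem_filter, Finset.mem_Icc, Finset.mem_Ico,
        Finset.mem_Ioc]
      · exact ⟨fun h => ⟨h.1.1, h.2.1⟩, fun h => ⟨⟨h.1, h.2.le⟩, h.2, this ⟨hj, h.1, h.2.le⟩⟩⟩
      · exact ⟨fun h => ⟨h.2.1, h.1.2⟩, fun h => ⟨⟨h.1.le, h.2⟩, h.1, this ⟨hj, h.1.le, h.2⟩⟩⟩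
    rw [this]
    split_ifs <;> simp
  rw [Finset.sum_congr rfl this, Finset.sum_const, smul_eq_mul]
  push_cast
  rw [Int.toNat_of_nonneg (by omega), mul_comm]

theorem IsAPark.exists_notMem {n : ℕ} {a : ℤ} (ha : 1 ≤ a) {f : Fin n → ℤ} (hf : IsAPark a f)
    {S : Finset (Fin n)} (hS : S.card < n) : ∃ i ∉ S, f i ≤ a * S.card := by
  obtain ⟨-, τ, -, hτ⟩ := hf
  by_contra! hcon
  have hsub : (Finset.Iic (⟨S.card, hS⟩ : Fin n)).map τ.toEmbedding ⊆ S := by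
    intro i hi
    obtain ⟨j, hj, rfl⟩ := Finset.mem_map.1 hi
    by_contra hn
    have h1 := hcon _ hn
    have h2 := hτ j
    have h3 : (j : ℕ) ≤ S.card := by simpa [Fin.le_def] using hj
    have h4 : a * (j : ℤ) ≤ a * (S.card : ℤ) :=
      mul_le_mul_of_nonneg_left (by exact_mod_cast h3) (by omega)
    simp only [Equiv.toEmbedding_apply] at h1
    omega
  have := Finset.card_le_card hsub
  simp at this

/-- One may find a height at which some vertex outside `S` has hit exactly as many
hyperplanes as prescribed, and no vertex outside `S` has hit more. -/
theorem exists_height {n : ℕ} {a : ℤ} (ha : 1 ≤ a) {f : Fin n → ℤ} {S : Finset (Fin n)}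
    (hex : ∃ i ∉ S, f i ≤ a * S.card) {x : Fin n → ℝ} {t₀ : ℝ}
    (hgen : ∀ j ∈ S, ∀ j' ∈ S, j ≠ j' → ∀ k : ℤ, 0 ≤ k → k ≤ a → x j + k ≠ x j')
    (hle : ∀ i ∉ S, ((hits a S x i t₀).card : ℤ) ≤ f i) :
    ∃ e ≥ t₀, (∀ i ∉ S, ((hits a S x i e).card : ℤ) ≤ f i) ∧
      ∃ i ∉ S, f i ≤ (hits a S x i e).card := by
  classical
  have hval : ∀ p ∈ S ×ˢ Finset.Icc (0 : ℤ) a, ∀ q ∈ S ×ˢ Finset.Icc (0 : ℤ) a,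
      x p.1 + p.2 = x q.1 + q.2 → p = q := by
    rintro ⟨j, k⟩ hp ⟨j', k'⟩ hq h
    simp only [Finset.mem_product, Finset.mem_Icc] at hp hq h
    by_cases hj : j = j'
    · subst hj
      simpa using h
    · exfalso
      rcases le_total k k' with hk | hk
      · refine hgen j' hq.1 j hp.1 (Ne.symm hj) (k' - k) (by omega) (by omega) ?_
        push_cast
        linarith
      · refine hgen j hp.1 j' hq.1 hj (k - k') (by omega) (by omega) ?_
        push_cast
        linarith
  set E : Finset ℝ := insert t₀ (((S ×ˢ Finset.Icc (0 : ℤ) a).image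
    fun p => x p.1 + (p.2 : ℝ)).filter fun y => t₀ < y) with hE
  have hE0 : t₀ ∈ E := Finset.mem_insert_self _ _
  have hEval : ∀ p ∈ S ×ˢ Finset.Icc (0 : ℤ) a, t₀ < x p.1 + p.2 → x p.1 + p.2 ∈ E :=
    fun p hp h => Finset.mem_insert_of_mem
      (Finset.mem_filter.2 ⟨Finset.mem_image.2 ⟨p, hp, rfl⟩, h⟩)
  have hEge : ∀ y ∈ E, t₀ ≤ y := by
    intro y hy
    rcases Finset.mem_insert.1 hy with rfl | hy
    · exact le_rfl
    · exact (Finset.mem_filter.1 hy).2.le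
  set M := E.filter fun e => ∃ i ∉ S, f i ≤ (hits a S x i e).card with hM
  have hMne : M.Nonempty := by
    refine ⟨E.max' ⟨t₀, hE0⟩, Finset.mem_filter.2 ⟨Finset.max'_mem _ _, ?_⟩⟩
    obtain ⟨i, hi, hfi⟩ := hex
    refine ⟨i, hi, ?_⟩
    rw [card_hits_of_forall_le ha]
    · exact hfi
    · intro p hp
      rcases le_or_gt (x p.1 + p.2) t₀ with h | h
      · exact h.trans (Finset.le_max' _ _ hE0)
      · exact Finset.le_max' _ _ (hEval p hp h)
  obtain ⟨heE, heM⟩ := Finset.mem_filter.1 (M.min'_mem hMne)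
  set e := M.min' hMne with he
  refine ⟨e, hEge e heE, ?_, heM⟩
  intro i hi
  rcases Finset.mem_insert.1 heE with h0 | h0
  · rw [h0]; exact hle i hi
  obtain ⟨him, hlt⟩ := Finset.mem_filter.1 h0
  obtain ⟨p, hp, hpe⟩ := Finset.mem_image.1 him
  have hne : (E.filter fun y => y < e).Nonempty := ⟨t₀, Finset.mem_filter.2 ⟨hE0, hlt⟩⟩
  obtain ⟨h1, h2⟩ := Finset.mem_filter.1 (Finset.max'_mem _ hne)
  set e' := (E.filter fun y => y < e).max' hne with he'
  have hnot : e' ∉ M := fun h => absurd (M.min'_le e' h) (not_le.2 h2)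
  have hlt' : ((hits a S x i e').card : ℤ) < f i := by
    by_contra! hcon
    exact hnot (Finset.mem_filter.2 ⟨h1, i, hi, hcon⟩)
  have hsub : hits a S x i e ⊆ insert p (hits a S x i e') := by
    intro q hq
    rw [mem_hits] at hq
    have hqm : q ∈ S ×ˢ Finset.Icc (0 : ℤ) a := by simpa using hq.1
    rcases hq.2.2.lt_or_eq with hqe | hqe
    · refine Finset.mem_insert_of_mem (mem_hits.2 ⟨hq.1, hq.2.1, ?_⟩)
      rcases le_or_gt (x q.1 + q.2) t₀ with h | h
      · exact h.trans (hEge _ h1)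
      · exact Finset.le_max' _ _ (Finset.mem_filter.2 ⟨hEval q hqm h, hqe⟩)
    · rw [hval q hqm p hp (by rw [hqe, hpe])]
      exact Finset.mem_insert_self _ _
  have := (Finset.card_le_card hsub).trans (Finset.card_insert_le _ _)
  omega

theorem exists_heights {n : ℕ} {a : ℤ} (ha : 1 ≤ a) {f : Fin n → ℤ} (hf : IsAPark a f) :
    ∃ x : Fin n → ℝ, (∀ j j', j ≠ j' → ∀ k : ℤ, 0 ≤ k → k ≤ a → x j + k ≠ x j') ∧
      ∀ i, ((hits a Finset.univ x i (x i)).card : ℤ) = f i := by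
  have main : ∀ m ≤ n, ∃ (S : Finset (Fin n)) (x : Fin n → ℝ) (t₀ : ℝ), S.card = m ∧
      (∀ j ∈ S, x j ≤ t₀) ∧
      (∀ j ∈ S, ∀ j' ∈ S, j ≠ j' → ∀ k : ℤ, 0 ≤ k → k ≤ a → x j + k ≠ x j') ∧
      (∀ i ∈ S, ((hits a S x i (x i)).card : ℤ) = f i) ∧
      (∀ i ∉ S, ((hits a S x i t₀).card : ℤ) ≤ f i) := by
    intro m
    induction m with
    | zero =>
      refine fun _ => ⟨∅, fun _ => 0, 0, by simp, by simp, by simp, by simp, fun i _ => ?_⟩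
      simpa [hits] using hf.1 i
    | succ m ih =>
      intro hm
      obtain ⟨S, x, t₀, hc, hx, hgen, heq, hle⟩ := ih (by omega)
      obtain ⟨e, het, hle', i₁, hi₁, hfi₁⟩ :=
        exists_height ha (hf.exists_notMem ha (S := S) (by omega)) hgen hle
      obtain ⟨i₀, hi₀, hmax⟩ := Finset.exists_max_image
        (Finset.univ.filter fun i => i ∉ S ∧ f i ≤ (hits a S x i e).card) id
        ⟨i₁, by simp [hi₁, hfi₁]⟩
      simp only [Finset.mem_filter, Finset.mem_univ, true_and, id] at hi₀ hmax
      obtain ⟨hi₀S, hfi₀⟩ := hi₀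
      obtain ⟨t, hte, ht⟩ := exists_gt_below
        ((S ×ˢ Finset.Icc (0 : ℤ) a).image fun p => x p.1 + (p.2 : ℝ)).finite_toSet e
      have hval : ∀ j ∈ S, ∀ k : ℤ, 0 ≤ k → k ≤ a → e < x j + k → t < x j + k := by
        intro j hj k hk hk' h
        refine ht _ ?_ h
        simp only [Finset.coe_image, Set.mem_image, Finset.mem_coe, Finset.mem_product,
          Finset.mem_Icc]
        exact ⟨(j, k), ⟨hj, hk, hk'⟩, rfl⟩
      have hneS : ∀ j ∈ S, j ≠ i₀ := fun j hj h => hi₀S (h ▸ hj)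
      have hup : ∀ j ∈ S, Function.update x i₀ t j = x j := fun j hj =>
        Function.update_of_ne (hneS j hj) _ _
      have hself : Function.update x i₀ t i₀ = t := Function.update_self _ _ _
      refine ⟨insert i₀ S, Function.update x i₀ t, t,
        by rw [Finset.card_insert_of_notMem hi₀S, hc], ?_, ?_, ?_, ?_⟩
      · intro j hj
        rcases Finset.mem_insert.1 hj with rfl | hj
        · rw [hself]
        · rw [hup j hj]
          linarith [hx j hj]
      · intro j hj j' hj' hne k hk hk' h
        have hk0 : (0 : ℝ) ≤ k := by exact_mod_cast hk
        rcases Finset.mem_insert.1 hj with rfl | hj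
        · rcases Finset.mem_insert.1 hj' with rfl | hj'
          · exact hne rfl
          · rw [hself, hup j' hj'] at h
            linarith [hx j' hj']
        · rcases Finset.mem_insert.1 hj' with rfl | hj'
          · rw [hself, hup j ‹j ∈ S›] at h
            rcases le_or_gt (x j + k) e with h' | h'
            · linarith
            · linarith [hval j ‹j ∈ S› k hk hk' h']
          · rw [hup j hj, hup j' hj'] at h
            exact hgen j hj j' hj' hne k hk hk' h
      · intro i hi
        rcases Finset.mem_insert.1 hi with rfl | hi
        · have : hits a (insert i S) (Function.update x i t) i t = hits a S x i e := by
            ext ⟨j, k⟩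
            simp only [mem_hits, Finset.mem_insert]
            constructor
            · rintro ⟨⟨rfl | hj, hk, hk'⟩, hr, hv⟩
              · rw [if_neg (lt_irrefl _)] at hr
                rw [hself] at hv
                have : (0 : ℝ) < k := by exact_mod_cast hr
                linarith
              · refine ⟨⟨hj, hk, hk'⟩, hr, ?_⟩
                rw [hup j hj] at hv
                by_contra! hcon
                linarith [hval j hj k hk hk' hcon]
            · rintro ⟨⟨hj, hk, hk'⟩, hr, hv⟩
              refine ⟨⟨Or.inr hj, hk, hk'⟩, hr, ?_⟩
              rw [hup j hj]
              linarith
          rw [hself, this]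
          exact le_antisymm (hle' i hi₀S) hfi₀
        · have : hits a (insert i₀ S) (Function.update x i₀ t) i (x i) =
              hits a S x i (x i) := by
            ext ⟨j, k⟩
            simp only [mem_hits, Finset.mem_insert]
            constructor
            · rintro ⟨⟨rfl | hj, hk, hk'⟩, hr, hv⟩
              · rw [hself] at hv
                have : (0 : ℝ) ≤ k := by exact_mod_cast hk
                linarith [hx i ‹i ∈ S›]
              · rw [hup j hj] at hv
                exact ⟨⟨hj, hk, hk'⟩, hr, hv⟩
            · rintro ⟨⟨hj, hk, hk'⟩, hr, hv⟩
              refine ⟨⟨Or.inr hj, hk, hk'⟩, hr, ?_⟩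
              rwa [hup j hj]
          rw [hup i hi, this, heq i hi]
      · intro i hi
        rw [Finset.mem_insert, not_or] at hi
        have hmem : ∀ j k, (j, k) ∈ hits a (insert i₀ S) (Function.update x i₀ t) i t →
            (j, k) ∈ hits a S x i e ∨ ((j, k) = (i₀, 0) ∧ i₀ < i) := by
          intro j k
          simp only [mem_hits, Finset.mem_insert]
          rintro ⟨⟨rfl | hj, hk, hk'⟩, hr, hv⟩
          · right
            rw [hself] at hv
            have hk0 : (k : ℝ) ≤ 0 := by linarith
            have hk0' : k ≤ 0 := by exact_mod_cast hk0
            refine ⟨by rw [le_antisymm hk0' hk], ?_⟩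
            by_contra hcon
            rw [if_neg hcon] at hr
            omega
          · left
            refine ⟨⟨hj, hk, hk'⟩, hr, ?_⟩
            rw [hup j hj] at hv
            by_contra! hcon
            linarith [hval j hj k hk hk' hcon]
        by_cases hlt : i₀ < i
        · have h1 : ((hits a S x i e).card : ℤ) < f i := by
            by_contra! hcon
            exact absurd (hmax i ⟨hi.2, hcon⟩) (not_le.2 hlt)
          have hsub : hits a (insert i₀ S) (Function.update x i₀ t) i t ⊆
              insert (i₀, 0) (hits a S x i e) := by
            rintro ⟨j, k⟩ h
            rcases hmem j k h with h | h
            · exact Finset.mem_insert_of_mem h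
            · rw [h.1]; exact Finset.mem_insert_self _ _
          have := (Finset.card_le_card hsub).trans (Finset.card_insert_le _ _)
          omega
        · have hsub : hits a (insert i₀ S) (Function.update x i₀ t) i t ⊆ hits a S x i e := by
            rintro ⟨j, k⟩ h
            rcases hmem j k h with h | h
            · exact h
            · exact absurd h.2 hlt
          have := Finset.card_le_card hsub
          have := hle' i hi.2
          omega
  obtain ⟨S, x, t₀, hc, -, hgen, heq, -⟩ := main n le_rfl
  have : S = Finset.univ := by
    rw [← Finset.card_eq_iff_eq_univ, hc, Fintype.card_fin]
  subst this
  exact ⟨x, fun j j' => hgen j (Finset.mem_univ _) j' (Finset.mem_univ _),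
    fun i => heq i (Finset.mem_univ _)⟩

/-- The weight function of the region containing the point `x`. -/
noncomputable def weightOf {n : ℕ} (a : ℤ) (x : Fin n → ℝ) (i j : Fin n) : WithBot ℤ :=
  if i = j ∨ ⌊x i - x j⌋ < shiAlpha a i j then ⊥ else
    ((min ⌊x i - x j⌋ (shiBeta a i j) : ℤ) : WithBot ℤ)

theorem gain_weightOf {n : ℕ} (a : ℤ) (x : Fin n → ℝ) {i j : Fin n} (hij : i ≠ j) :
    gain a (weightOf a x) i j =
      if ⌊x i - x j⌋ < shiAlpha a i j then shiAlpha a i j - 1 else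
        min ⌊x i - x j⌋ (shiBeta a i j) := by
  unfold gain weightOf
  simp only [hij, false_or]
  split_ifs
  · simp
  · exact WithBot.unbotD_coe _ _

theorem floor_sub_comm {n : ℕ} {a : ℤ} {x : Fin n → ℝ}
    (hgen : ∀ j j', j ≠ j' → ∀ k : ℤ, 0 ≤ k → k ≤ a → x j + k ≠ x j') {i j : Fin n}
    (hij : i ≠ j) : ⌊x j - x i⌋ = -1 - ⌊x i - x j⌋ ∨
      (⌊x j - x i⌋ = -⌊x i - x j⌋ ∧ (a < ⌊x i - x j⌋ ∨ ⌊x i - x j⌋ < -a)) := by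
  have h1 := Int.floor_le (x i - x j)
  have h2 := Int.lt_floor_add_one (x i - x j)
  rcases h1.eq_or_lt with h | h
  · right
    have hfl : ⌊x j - x i⌋ = -⌊x i - x j⌋ := by
      rw [Int.floor_eq_iff]
      push_cast
      constructor <;> linarith
    refine ⟨hfl, ?_⟩
    by_contra! hcon
    rcases le_total 0 ⌊x i - x j⌋ with h0 | h0
    · exact hgen j i hij.symm _ h0 hcon.1 (by linarith)
    · refine hgen i j hij (-⌊x i - x j⌋) (by omega) (by omega) ?_
      push_cast
      linarith
  · left
    rw [Int.floor_eq_iff]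
    push_cast
    constructor <;> linarith

theorem valid_weightOf {n : ℕ} {a : ℤ} (ha : 1 ≤ a) {x : Fin n → ℝ}
    (hgen : ∀ j j', j ≠ j' → ∀ k : ℤ, 0 ≤ k → k ≤ a → x j + k ≠ x j') :
    ValidW (shiAlpha a) (shiBeta a) (weightOf a x) := by
  refine ⟨fun i => by simp [weightOf], fun i j hij => ?_⟩
  have hf := floor_sub_comm hgen hij
  have e1 := shiAlpha_eq a hij
  have e2 := shiAlpha_eq a hij.symm
  have b1 := shi_bounds (a := a) i j
  have b2 := shi_bounds (a := a) j i
  unfold weightOf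
  simp only [hij, hij.symm, false_or]
  refine ⟨?_, ?_, ?_⟩
  · split_ifs with h
    · simp
    · intro _
      rw [WithBot.coe_le_coe, WithBot.coe_le_coe]
      omega
  · split_ifs with h h' h'
    · simp only [WithBot.bot_ne_coe, iff_false]
      omega
    · simp only [true_iff, WithBot.coe_inj]
      omega
    · simp only [WithBot.coe_ne_bot, WithBot.bot_ne_coe]
    · simp only [WithBot.coe_ne_bot, WithBot.coe_inj, false_iff]
      omega
  · intro y z
    split_ifs with h h' h'
    · simp
    · simp
    · simp
    · rw [WithBot.coe_inj, WithBot.coe_inj]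
      omega

theorem weightOf_lt {n : ℕ} {a : ℤ} {x : Fin n → ℝ}
    (hgen : ∀ j j', j ≠ j' → ∀ k : ℤ, 0 ≤ k → k ≤ a → x j + k ≠ x j') {i j : Fin n}
    (h : weightOf a x i j ≠ ⊥) : ∃ k : ℤ, weightOf a x i j = k ∧ (k : ℝ) < x i - x j := by
  unfold weightOf at h ⊢
  split_ifs at h ⊢ with hc
  · exact absurd rfl h
  · refine ⟨_, rfl, ?_⟩
    rw [not_or] at hc
    have hf := floor_sub_comm hgen (Ne.symm hc.1)
    have b1 := shi_bounds (a := a) i j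
    have h1 := Int.floor_le (x i - x j)
    rcases lt_or_ge (shiBeta a i j) ⌊x i - x j⌋ with hlt | hge
    · rw [min_eq_right hlt.le]
      have : ((shiBeta a i j : ℤ) : ℝ) < (⌊x i - x j⌋ : ℝ) := by exact_mod_cast hlt
      linarith
    · rw [min_eq_left hge]
      refine lt_of_le_of_ne h1 fun heq => ?_
      have : x j - x i = ((-⌊x i - x j⌋ : ℤ) : ℝ) := by
        push_cast
        linarith
      have h3 : ⌊x j - x i⌋ = -⌊x i - x j⌋ := by
        rw [this, Int.floor_intCast]
      omega

theorem sum_weights_lt {n : ℕ} {w : Fin n → Fin n → WithBot ℤ} {x : Fin n → ℝ}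
    (hw : ∀ i j, w i j ≠ ⊥ → ∃ k : ℤ, w i j = k ∧ (k : ℝ) < x i - x j)
    (l : List (Fin n × Fin n)) (hl : ∀ p ∈ l, w p.1 p.2 ≠ ⊥) :
    ∃ k : ℤ, (l.map fun p => w p.1 p.2).sum = k ∧
      (k : ℝ) ≤ ((l.map Prod.fst).map x).sum - ((l.map Prod.snd).map x).sum ∧
      (l ≠ [] → (k : ℝ) < ((l.map Prod.fst).map x).sum - ((l.map Prod.snd).map x).sum) := by
  induction l with
  | nil => exact ⟨0, by simp⟩
  | cons p l ih =>
    obtain ⟨k, h1, h2, -⟩ := ih fun q hq => hl q (List.mem_cons_of_mem _ hq)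
    obtain ⟨k', h1', h2'⟩ := hw p.1 p.2 (hl p List.mem_cons_self)
    have : ((k' + k : ℤ) : ℝ) < (((p :: l).map Prod.fst).map x).sum -
        (((p :: l).map Prod.snd).map x).sum := by
      simp only [List.map_cons, List.sum_cons]
      push_cast
      linarith
    refine ⟨k' + k, ?_, this.le, fun _ => this⟩
    rw [List.map_cons, List.sum_cons, h1, h1', WithBot.coe_add]

theorem mAcyclic_weightOf {n : ℕ} {a : ℤ} {x : Fin n → ℝ}
    (hgen : ∀ j j', j ≠ j' → ∀ k : ℤ, 0 ≤ k → k ≤ a → x j + k ≠ x j') :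
    MAcyclic (weightOf a x) := by
  rintro c ⟨⟨hlen, -, hc⟩, hpos⟩
  obtain ⟨k, h1, -, h2⟩ := sum_weights_lt (fun i j => weightOf_lt (i := i) (j := j) hgen) (cpairs c) hc
  have hfst : (cpairs c).map Prod.fst = c := List.map_fst_zip (by simp)
  have hsnd : (cpairs c).map Prod.snd = c.rotate 1 := List.map_snd_zip (by simp)
  have hsum : ((c.rotate 1).map x).sum = (c.map x).sum :=
    ((List.rotate_perm c 1).map x).sum_eq
  have hne : cpairs c ≠ [] := by
    intro h
    rw [h] at hfst
    rw [← hfst] at hlen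
    simp at hlen
  have := h2 hne
  rw [hfst, hsnd, hsum, sub_self] at this
  unfold cycWeight at hpos
  rw [h1] at hpos
  have h0 : 0 ≤ k := by exact_mod_cast hpos
  have : k < 0 := by exact_mod_cast this
  omega

theorem gainLabel_weightOf {n : ℕ} {a : ℤ} (ha : 1 ≤ a) (x : Fin n → ℝ) (i : Fin n) :
    gainLabel (gain a (weightOf a x)) i = (hits a Finset.univ x i (x i)).card := by
  unfold gainLabel hits
  rw [Finset.card_filter, Finset.sum_product]
  push_cast
  refine Finset.sum_congr rfl fun j _ => ?_
  have hiff : ∀ k : ℤ, x j + k ≤ x i ↔ k ≤ ⌊x i - x j⌋ := by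
    intro k
    rw [Int.le_floor]
    constructor <;> intro h <;> linarith
  have hsum : (∑ k ∈ Finset.Icc (0 : ℤ) a,
      if (if j < i then k < a else 0 < k) ∧ x j + k ≤ x i then (1 : ℤ) else 0) =
      ((Finset.Icc (if j < i then 0 else 1)
        (min ⌊x i - x j⌋ (if j < i then a - 1 else a))).card : ℤ) := by
    rw [← Finset.sum_filter, Finset.sum_const, nsmul_one]
    congr 2
    ext k
    simp only [Finset.mem_filter, Finset.mem_Icc, hiff]
    split_ifs <;> omega
  rw [hsum, Int.card_Icc]
  by_cases hij : i = j
  · subst hij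
    have : gain a (weightOf a x) i i = -a - 1 := by
      simp [gain, weightOf, shiAlpha]
    rw [this]
    simp only [lt_irrefl, if_false, sub_self, Int.floor_zero]
    rw [if_neg (by omega)]
    omega
  · rw [gain_weightOf a x hij]
    unfold shiAlpha shiBeta
    rcases lt_or_gt_of_ne hij with h | h
    · simp only [h, h.not_gt, if_true, if_false]
      split_ifs <;> omega
    · simp only [h, h.not_gt, if_true, if_false]
      split_ifs <;> omega

theorem stmt16 (n : ℕ) (hn : 1 ≤ n) (a : ℤ) (ha : 1 ≤ a) :
    ∃ F : {w : Fin n → Fin n → WithBot ℤ // ValidW (shiAlpha a) (shiBeta a) w ∧ MAcyclic w}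
        → {f : Fin n → ℤ // IsAPark a f},
      (∀ w σ, (∀ i j : Fin n, i < j → 0 ≤ w.1 (σ i) (σ j)) → IsPSLabel σ w.1 (F w).1) ∧
      Function.Bijective F := by
  refine ⟨fun w => ⟨gainLabel (gain a w.1), isAPark_gainLabel ha (valid_gain ha w.2.1 w.2.2)⟩,
    fun w σ hσ => isPSLabel_gainLabel (valid_gain ha w.2.1 w.2.2) σ hσ, ?_, ?_⟩
  · intro w w' h
    exact Subtype.ext (gain_injective w.2.1 w'.2.1 (gainLabel_injective ha
      (valid_gain ha w.2.1 w.2.2) (valid_gain ha w'.2.1 w'.2.2) (Subtype.ext_iff.1 h)))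
  · rintro ⟨f, hf⟩
    obtain ⟨x, hgen, hx⟩ := exists_heights ha hf
    refine ⟨⟨weightOf a x, valid_weightOf ha hgen, mAcyclic_weightOf hgen⟩,
      Subtype.ext (funext fun i => ?_)⟩
    exact (gainLabel_weightOf ha x i).trans (hx i)
end

section
/- Let a ≥ 1 and n ≥ 1 be integers. The number of valid m-acyclic weight functions of the a-Catalan arrangement 𝒜^{a,a}_{n−1} (equivalently, the number of regions of the a-Catalan arrangement) equals an · (an−1) ⋯ ((a−1)n + 2), i.e., (an)! / ((a−1)n + 1)!. -/
open Finset

/-- The weight `w i j` as an integer, with the value `-a` standing for `-∞`. -/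
def intWeight {n : ℕ} (a : ℕ) (w : Fin n → Fin n → WithBot ℤ) (i j : Fin n) : ℤ :=
  (w i j).unbotD (-(a : ℤ))

/-- The number of points `x j + t`, `0 ≤ t < a`, lying below `x i`, for any point `x` of the
region described by the weights `W`. -/
def rankBelow {n : ℕ} (W : Fin n → Fin n → ℤ) (i : Fin n) : ℕ := ∑ j, (W i j + 1).toNat

/-- Integer weights that come from a valid weight function without ascending triangles. -/
structure IsTriangular {n : ℕ} (a : ℕ) (W : Fin n → Fin n → ℤ) : Prop where
  lower : ∀ i j, -(a : ℤ) ≤ W i j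
  upper : ∀ i j, W i j ≤ a - 1
  diag : ∀ i, W i i = -a
  anti : ∀ i j, i ≠ j → W j i = -1 - W i j
  tri : ∀ i j k, i ≠ j → j ≠ k → k ≠ i →
    W i j = -a ∨ W j k = -a ∨ W k i = -a ∨ W i j + W j k + W k i < 0

theorem isTriangular_intWeight {n a : ℕ} (ha : 1 ≤ a) {w : Fin n → Fin n → WithBot ℤ}
    (hv : ValidW (fun _ _ => 1 - (a : ℤ)) (fun _ _ => (a : ℤ) - 1) w) (hw : MAcyclic w) :
    IsTriangular a (intWeight a w) := by
  obtain ⟨hd, hv⟩ := hv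
  have hrange : ∀ i j, -(a : ℤ) ≤ intWeight a w i j ∧ intWeight a w i j ≤ a - 1 := by
    intro i j
    by_cases hij : i = j
    · subst hij
      simp only [intWeight, hd, WithBot.unbotD_bot]
      omega
    · have h := (hv i j hij).1
      unfold intWeight
      cases hx : w i j with
      | bot => simp only [WithBot.unbotD_bot]; omega
      | coe x =>
        rw [hx] at h
        have h := h WithBot.coe_ne_bot
        simp only [WithBot.coe_le_coe] at h
        simp only [WithBot.unbotD_coe]
        omega
  have hbot : ∀ i j, intWeight a w i j ≠ -a → ∃ x : ℤ, w i j = x ∧ intWeight a w i j = x := by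
    intro i j h
    unfold intWeight at h ⊢
    cases hx : w i j with
    | bot => simp [hx] at h
    | coe x => exact ⟨x, rfl, by simp⟩
  refine ⟨fun i j => (hrange i j).1, fun i j => (hrange i j).2, fun i => by simp [intWeight, hd],
    ?_, ?_⟩
  · intro i j hij
    obtain ⟨-, h2, h3⟩ := hv i j hij
    obtain ⟨-, h2', -⟩ := hv j i hij.symm
    unfold intWeight
    cases hx : w i j with
    | bot =>
      rw [h2.1 hx]
      simp only [WithBot.unbotD_bot, WithBot.unbotD_coe]
      omega
    | coe x =>
      cases hy : w j i with
      | bot =>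
        have := h2'.1 hy
        simp only [hx, WithBot.coe_inj] at this
        simp only [WithBot.unbotD_bot, WithBot.unbotD_coe]
        omega
      | coe y => simpa using h3 x y hx hy
  · intro i j k hij hjk hki
    by_contra! h
    obtain ⟨h1, h2, h3, h4⟩ := h
    obtain ⟨x, hx, hx'⟩ := hbot i j h1
    obtain ⟨y, hy, hy'⟩ := hbot j k h2
    obtain ⟨z, hz, hz'⟩ := hbot k i h3
    refine hw [i, j, k] ⟨⟨by simp, by simp [hij, hjk, hki.symm], ?_⟩, ?_⟩
    · simp [cpairs, hx, hy, hz]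
    · simp only [cycWeight, cpairs, List.rotate_cons_succ, List.rotate_zero, List.cons_append,
        List.nil_append, List.zip_cons_cons, List.zip_nil_left, List.map_cons, List.map_nil,
        List.sum_cons, List.sum_nil, hx, hy, hz, add_zero]
      rw [hx', hy', hz'] at h4
      norm_cast
      omega

namespace IsTriangular

variable {n a : ℕ} {W W' : Fin n → Fin n → ℤ}

theorem rankBelow_lt (h : IsTriangular a W) {i j : Fin n} (hij : i ≠ j) (hW : 0 ≤ W i j) :
    rankBelow W j < rankBelow W i := by
  have hi := h.anti i j hij
  refine Finset.sum_lt_sum (fun k _ => ?_) ⟨j, mem_univ j, ?_⟩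
  · rcases eq_or_ne k i with rfl | hki
    · omega
    rcases eq_or_ne j k with rfl | hjk
    · have := h.diag j
      omega
    have h1 := h.tri i j k hij hjk hki
    have h2 := h.anti i k hki.symm
    have h3 := h.upper j k
    omega
  · have := h.diag j
    have := h.upper i j
    omega

theorem nonneg_iff (h : IsTriangular a W) {i j : Fin n} (hij : i ≠ j) :
    0 ≤ W i j ↔ rankBelow W j < rankBelow W i := by
  refine ⟨h.rankBelow_lt hij, fun hlt => ?_⟩
  by_contra hneg
  have := h.rankBelow_lt hij.symm (by have := h.anti i j hij; omega)
  omega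

theorem rankBelow_injective (h : IsTriangular a W) : Function.Injective (rankBelow W) := by
  intro i j hf
  by_contra hij
  have h1 := h.anti i j hij
  have h2 := h.nonneg_iff hij
  have h3 := h.nonneg_iff (Ne.symm hij)
  omega

theorem rankBelow_le (h : IsTriangular a W) (ha : 1 ≤ a) (i : Fin n) :
    rankBelow W i ≤ a * #{j | rankBelow W j < rankBelow W i} := by
  rw [mul_comm, ← smul_eq_mul, ← Finset.sum_const, Finset.sum_filter]
  refine Finset.sum_le_sum fun j _ => ?_
  have h1 := h.upper i j
  split_ifs with hlt
  · omega
  · rcases eq_or_ne i j with rfl | hij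
    · have := h.diag i
      omega
    · have := h.nonneg_iff hij
      omega

theorem eq_of_rankBelow_eq (h : IsTriangular a W) (h' : IsTriangular a W') (ha : 1 ≤ a)
    (hf : rankBelow W = rankBelow W') : W = W' := by
  have key : ∀ m i, rankBelow W i = m → ∀ j, rankBelow W j < m → W i j = W' i j := by
    intro m
    induction m using Nat.strong_induction_on with
    | _ m ih =>
    intro i hi
    have hS : ∀ j k, j ≠ k → rankBelow W j < m → rankBelow W k < m → W j k = W' j k := by
      intro j k hjk hj hk
      rcases lt_or_gt_of_ne (h.rankBelow_injective.ne hjk) with hlt | hlt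
      · have := ih _ hk k rfl j hlt
        have h1 := h.anti k j hjk.symm
        have h2 := h'.anti k j hjk.symm
        omega
      · exact ih _ hj j rfl k hlt
    have hno : ∀ j k, W i j < W' i j → rankBelow W j < m → W' i k < W i k →
        rankBelow W k < m → False := by
      intro j k hj hjm hk hkm
      have hij : i ≠ j := by rintro rfl; omega
      have hik : i ≠ k := by rintro rfl; omega
      have hjk : j ≠ k := by rintro rfl; omega
      have e1 := hS j k hjk hjm hkm
      have e2 := h.tri i k j hik hjk.symm hij.symm
      have e3 := h'.tri i j k hij hjk hik.symm
      have e4 := h.anti i j hij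
      have e5 := h'.anti i k hik
      have e6 := h.anti j k hjk
      have e7 := h.upper i k
      have e8 := h'.upper i j
      have e9 := (h.nonneg_iff hij).2 (hi ▸ hjm)
      have e10 := (h'.nonneg_iff hik).2 (hf ▸ hi ▸ hkm)
      omega
    have hsum : ∑ j, (W i j + 1).toNat = ∑ j, (W' i j + 1).toNat := congrFun hf i
    have hz : ∀ j, ¬ rankBelow W j < m → (W i j + 1).toNat = 0 ∧ (W' i j + 1).toNat = 0 := by
      intro j hj
      rcases eq_or_ne i j with rfl | hij
      · have := h.diag i
        have := h'.diag i
        omega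
      have h1 := h.nonneg_iff hij
      have h2 := h'.nonneg_iff hij
      rw [← hf] at h2
      omega
    have hp : ∀ j, rankBelow W j < m → 0 ≤ W i j ∧ 0 ≤ W' i j := by
      intro j hj
      have hij : i ≠ j := by rintro rfl; omega
      have h1 := h.nonneg_iff hij
      have h2 := h'.nonneg_iff hij
      rw [← hf] at h2
      omega
    intro j hj
    have hpj := hp j hj
    rcases lt_trichotomy (W i j) (W' i j) with hlt | heq | hlt
    · exfalso
      refine hsum.not_lt (Finset.sum_lt_sum (fun k _ => ?_) ⟨j, mem_univ j, by omega⟩)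
      by_cases hk : rankBelow W k < m
      · have := hno j k hlt hj
        by_contra hc
        exact this (by omega) hk
      · have := hz k hk
        omega
    · exact heq
    · exfalso
      refine hsum.not_gt (Finset.sum_lt_sum (fun k _ => ?_) ⟨j, mem_univ j, by omega⟩)
      by_cases hk : rankBelow W k < m
      · by_contra hc
        exact hno k j (by omega) hk hlt hj
      · have := hz k hk
        omega
  funext i j
  rcases eq_or_ne i j with rfl | hij
  · rw [h.diag, h'.diag]
  rcases lt_or_gt_of_ne (h.rankBelow_injective.ne hij) with hlt | hlt
  · have := key _ j rfl i hlt
    have h1 := h.anti j i hij.symm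
    have h2 := h'.anti j i hij.symm
    omega
  · exact key _ i rfl j hlt

end IsTriangular

/-- The position functions satisfying the ballot condition. -/
def BallotFunctions (n a : ℕ) : Set (Fin n → ℕ) :=
  {f | Function.Injective f ∧ (∀ i, f i ≤ a * n) ∧ ∀ m ≤ a * n, m ≤ a * #{i | f i < m}}

theorem mem_ballotFunctions {n a : ℕ} {f : Fin n → ℕ} (hf : Function.Injective f)
    (h : ∀ i, f i ≤ a * #{j | f j < f i}) : f ∈ BallotFunctions n a := by
  refine ⟨hf, fun i => (h i).trans (Nat.mul_le_mul_left a ?_), fun m hm => ?_⟩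
  · simpa using Finset.card_le_univ {j | f j < f i}
  · by_cases hex : ∃ i, m ≤ f i
    · obtain ⟨i, hi, hmin⟩ := Finset.exists_min_image {i | m ≤ f i} f
        (hex.imp fun i hi => by simpa using hi)
      simp only [mem_filter, mem_univ, true_and] at hi hmin
      refine hi.trans ((h i).trans (Nat.mul_le_mul_left a (Finset.card_le_card fun j hj => ?_)))
      simp only [mem_filter, mem_univ, true_and] at hj ⊢
      by_contra hc
      have := hmin j (by omega)
      omega
    · push Not at hex
      simpa [Finset.filter_true_of_mem fun i _ => hex i] using hm

/-! ### The cycle lemma -/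

theorem ballotFunctions_rotation_unique {n a : ℕ} {f g : Fin n → ℕ} (hf : f ∈ BallotFunctions n a)
    (hg : g ∈ BallotFunctions n a) {r s : ℕ} (hr : r < a * n + 1) (hs : s < a * n + 1)
    (h : ∀ i, (f i + r) % (a * n + 1) = (g i + s) % (a * n + 1)) : ¬ r < s := by
  intro hrs
  have h1 := hf.2.2 (s - r) (by omega)
  have h2 := hg.2.2 (a * n + 1 - (s - r)) (by omega)
  have hdisj : Disjoint ({i | f i < s - r} : Finset (Fin n))
      ({i | g i < a * n + 1 - (s - r)} : Finset (Fin n)) := by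
    rw [Finset.disjoint_filter]
    intro i _ hfi hgi
    have hi := h i
    have : (f i + r) % (a * n + 1) = (g i + (s - r) + r) % (a * n + 1) := by
      rw [hi]; congr 1; omega
    have := Nat.ModEq.add_right_cancel' r this
    rw [Nat.ModEq, Nat.mod_eq_of_lt (by omega), Nat.mod_eq_of_lt (by omega)] at this
    omega
  have h3 := Finset.card_union_of_disjoint hdisj
  have h4 := Finset.card_le_univ (({i | f i < s - r} : Finset (Fin n)) ∪
    ({i | g i < a * n + 1 - (s - r)} : Finset (Fin n)))
  rw [h3, Fintype.card_fin] at h4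
  have h5 := Nat.mul_le_mul_left a h4
  rw [mul_add] at h5
  omega

theorem exists_rotation_mem_ballotFunctions {n a : ℕ} {g : Fin n → ℕ}
    (hg : Function.Injective g) (hlt : ∀ i, g i < a * n + 1) :
    ∃ f ∈ BallotFunctions n a, ∃ r < a * n + 1, ∀ i, (f i + r) % (a * n + 1) = g i := by
  set N := a * n + 1 with hN
  let c : ℕ → ℕ := fun k => #{i | g i < k}
  let h : ℕ → ℤ := fun k => k - a * c k
  obtain ⟨r, hr, hmax⟩ := Finset.exists_max_image (range N) (fun k => h k * (N + 1) - k)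
    ⟨0, by simp [hN]⟩
  simp only [mem_range] at hr hmax
  have hge : ∀ k, k < N → h k ≤ h r := by
    intro k hk
    have := hmax k hk
    by_contra! hc
    have : h r + 1 ≤ h k := hc
    nlinarith
  have hgt : ∀ k, k < r → h k < h r := by
    intro k hk
    have := hmax k (hk.trans hr)
    by_contra! hc
    have : (k : ℤ) < r := by exact_mod_cast hk
    nlinarith
  have hrot : ∀ i, ((g i + (N - r)) % N + r) % N = g i := by
    intro i
    rw [Nat.mod_add_mod, show g i + (N - r) + r = g i + N by omega, Nat.add_mod_right,
      Nat.mod_eq_of_lt (hlt i)]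
  have hval : ∀ i, (r ≤ g i ∧ (g i + (N - r)) % N = g i - r) ∨
      (g i < r ∧ (g i + (N - r)) % N = g i + N - r) := by
    intro i
    have := hlt i
    rcases le_or_gt r (g i) with hi | hi
    · left
      refine ⟨hi, ?_⟩
      rw [show g i + (N - r) = (g i - r) + N by omega, Nat.add_mod_right,
        Nat.mod_eq_of_lt (by omega)]
    · right
      refine ⟨hi, ?_⟩
      rw [Nat.mod_eq_of_lt (by omega)]
      omega
  refine ⟨fun i => (g i + (N - r)) % N, ⟨?_, fun i => ?_, fun m hm => ?_⟩, r, hr, hrot⟩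
  · intro i j hij
    apply hg
    rw [← hrot i, ← hrot j]
    simp only at hij
    rw [hij]
  · have : (g i + (N - r)) % N < N := Nat.mod_lt _ (by omega)
    simp only
    omega
  · set d : ℕ := #{i | (g i + (N - r)) % N < m} with hd
    rcases lt_or_ge (r + m) N with hk | hk
    · have h1 : c (r + m) ≤ c r + d := by
        refine (Finset.card_le_card fun i hi => ?_).trans (Finset.card_union_le _ _)
        have := hval i
        simp only [mem_filter, mem_univ, true_and, mem_union] at hi ⊢
        omega
      have h2 := hge _ hk
      have h3 : (a : ℤ) * c (r + m) ≤ a * c r + a * d := by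
        have := Nat.mul_le_mul_left a h1
        rw [mul_add] at this
        exact_mod_cast this
      simp only [h] at h2
      push_cast at h2
      zify
      linarith
    · have h1 : n + c (r + m - N) ≤ c r + d := by
        have e1 : #({i | r ≤ g i} : Finset (Fin n)) + c r = n := by
          have := Finset.card_filter_add_card_filter_not (s := (univ : Finset (Fin n)))
            (fun i => r ≤ g i)
          simpa using this
        have e2 : #({i | r ≤ g i} : Finset (Fin n)) + c (r + m - N) ≤ d := by
          rw [← Finset.card_union_of_disjoint]
          · refine Finset.card_le_card fun i hi => ?_
            have := hval i
            have := hlt i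
            simp only [mem_filter, mem_univ, true_and, mem_union] at hi ⊢
            omega
          · rw [Finset.disjoint_filter]
            intro i _ _
            omega
        omega
      have h2 := hgt (r + m - N) (by omega)
      have h3 : (a : ℤ) * n + a * c (r + m - N) ≤ a * c r + a * d := by
        have := Nat.mul_le_mul_left a h1
        rw [mul_add, mul_add] at this
        exact_mod_cast this
      simp only [h] at h2
      have h4 : ((r + m - N : ℕ) : ℤ) = r + m - (a * n + 1) := by
        rw [Nat.cast_sub hk]; push_cast [hN]; ring
      rw [h4] at h2
      zify
      linarith

theorem ncard_injective_lt (n N : ℕ) :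
    {g : Fin n → ℕ | Function.Injective g ∧ ∀ i, g i < N}.ncard = N.descFactorial n := by
  have : {g : Fin n → ℕ | Function.Injective g ∧ ∀ i, g i < N} =
      (fun (e : Fin n ↪ Fin N) i => (e i : ℕ)) '' Set.univ := by
    ext g
    constructor
    · rintro ⟨hg, hlt⟩
      exact ⟨⟨fun i => ⟨g i, hlt i⟩, fun i j h => hg (by simpa using h)⟩, trivial, rfl⟩
    · rintro ⟨e, -, rfl⟩
      exact ⟨Fin.val_injective.comp e.injective, fun i => (e i).isLt⟩
  rw [this, Set.ncard_image_of_injective, Set.ncard_univ, Nat.card_eq_fintype_card,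
    Fintype.card_embedding_eq, Fintype.card_fin, Fintype.card_fin]
  intro e e' h
  ext i
  exact congrFun h i

theorem ncard_ballotFunctions {n a : ℕ} (ha : 1 ≤ a) :
    (BallotFunctions n a).ncard = (a * n).factorial / ((a - 1) * n + 1).factorial := by
  have hbij : Set.BijOn (fun (p : (Fin n → ℕ) × ℕ) i => (p.1 i + p.2) % (a * n + 1))
      (BallotFunctions n a ×ˢ Set.Iio (a * n + 1))
      {g : Fin n → ℕ | Function.Injective g ∧ ∀ i, g i < a * n + 1} := by
    have hcancel : ∀ {x y r : ℕ}, x ≤ a * n → y ≤ a * n →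
        (x + r) % (a * n + 1) = (y + r) % (a * n + 1) → x = y := by
      intro x y r hx hy hxy
      have := Nat.ModEq.add_right_cancel' r hxy
      rwa [Nat.ModEq, Nat.mod_eq_of_lt (by omega), Nat.mod_eq_of_lt (by omega)] at this
    refine ⟨?_, ?_, ?_⟩
    · rintro ⟨f, r⟩ ⟨hf, -⟩
      exact ⟨fun i j h => hf.1 (hcancel (hf.2.1 i) (hf.2.1 j) h),
        fun i => Nat.mod_lt _ (Nat.succ_pos _)⟩
    · rintro ⟨f, r⟩ ⟨hf, hr⟩ ⟨g, s⟩ ⟨hg, hs⟩ h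
      have h' := congrFun h
      simp only at hf hr hg hs h'
      have h1 := ballotFunctions_rotation_unique hf hg hr hs h'
      have h2 := ballotFunctions_rotation_unique hg hf hs hr fun i => (h' i).symm
      obtain rfl : r = s := by omega
      exact Prod.ext (funext fun i => hcancel (hf.2.1 i) (hg.2.1 i) (h' i)) rfl
    · rintro g ⟨hg, hlt⟩
      obtain ⟨f, hf, r, hr, h⟩ := exists_rotation_mem_ballotFunctions hg hlt
      exact ⟨(f, r), ⟨hf, hr⟩, funext h⟩
  have hcard := hbij.injOn.ncard_image
  rw [hbij.image_eq, ncard_injective_lt, Set.ncard_prod,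
    Set.ncard_eq_toFinset_card' (Set.Iio _)] at hcard
  simp only [Set.toFinset_Iio, Nat.card_Iio] at hcard
  obtain ⟨b, rfl⟩ : ∃ b, a = b + 1 := ⟨a - 1, by omega⟩
  have hsub : (b + 1) * n + 1 - n = b * n + 1 := by
    rw [add_mul, one_mul]; omega
  have hle : n ≤ (b + 1) * n + 1 := by rw [add_mul, one_mul]; omega
  have hfac := Nat.factorial_mul_descFactorial hle
  rw [hsub, hcard, Nat.factorial_succ ((b + 1) * n)] at hfac
  symm
  apply Nat.div_eq_of_eq_mul_left (Nat.factorial_pos _)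
  apply Nat.eq_of_mul_eq_mul_left (Nat.succ_pos ((b + 1) * n))
  rw [Nat.add_sub_cancel, Nat.succ_eq_add_one, ← hfac]
  ring

/-! ### Points of regions -/

theorem exists_card_filter_lt_eq {Z : Set ℝ} (hZ : Z.Countable) (P : Finset ℝ) :
    ∀ m ≤ #P, ∀ b, (∀ p ∈ P, p < b) → ∃ y < b, y ∉ Z ∧ #{p ∈ P | p < y} = m := by
  have hdense : ∀ u v : ℝ, u < v → ∃ y, u < y ∧ y < v ∧ y ∉ Z := by
    intro u v huv
    obtain ⟨y, hy, hy'⟩ := (hZ.dense_compl ℝ).exists_between huv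
    exact ⟨y, hy'.1, hy'.2, hy⟩
  induction P using Finset.induction_on_max with
  | empty =>
    intro m hm b _
    obtain ⟨y, -, hy, hyZ⟩ := hdense (b - 1) b (by linarith)
    exact ⟨y, hy, hyZ, by simpa using (Nat.le_zero.1 hm).symm⟩
  | insert q P hq ih =>
    intro m hm b hb
    have hqP : q ∉ P := fun h => (hq q h).false
    rw [Finset.card_insert_of_notMem hqP] at hm
    have hqb := hb q (Finset.mem_insert_self q P)
    rcases hm.lt_or_eq with hm | rfl
    · obtain ⟨y, hy, hyZ, hc⟩ := ih m (by omega) q hq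
      refine ⟨y, hy.trans hqb, hyZ, ?_⟩
      rw [Finset.filter_insert, if_neg hy.not_gt, hc]
    · obtain ⟨y, hqy, hy, hyZ⟩ := hdense q b hqb
      refine ⟨y, hy, hyZ, ?_⟩
      rw [Finset.filter_true_of_mem, Finset.card_insert_of_notMem hqP]
      intro p hp
      rcases Finset.mem_insert.1 hp with rfl | hp
      · exact hqy
      · exact (hq p hp).trans hqy

theorem exists_point_of_mem_ballotFunctions {n a : ℕ} {f : Fin n → ℕ}
    (hf : f ∈ BallotFunctions n a) : ∃ x : Fin n → ℝ,
      (∀ i j, i ≠ j → ∀ z : ℤ, x i - x j ≠ z) ∧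
      ∀ i, #{p ∈ (univ : Finset (Fin n)) ×ˢ range a | x p.1 + p.2 < x i} = f i := by
  have key : ∀ m : ℕ, ∃ x : Fin n → ℝ,
      (∀ i j, f i < m → f j < m → i ≠ j → ∀ z : ℤ, x i - x j ≠ z) ∧
      ∀ i, f i < m →
        #{p ∈ ({j | f j < m} : Finset (Fin n)) ×ˢ range a | x p.1 + p.2 < x i} = f i := by
    intro m
    induction m with
    | zero => exact ⟨0, by simp, by simp⟩
    | succ m ih =>
      obtain ⟨x, hgen, hx⟩ := ih
      by_cases hex : ∃ i, f i = m
      swap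
      · have hiff : ∀ i, f i < m + 1 ↔ f i < m := fun i => by
          have : f i ≠ m := fun h => hex ⟨i, h⟩
          omega
        refine ⟨x, ?_, ?_⟩ <;> simpa only [hiff]
      obtain ⟨i, hi⟩ := hex
      have hiff : ∀ j, f j < m + 1 ↔ j = i ∨ f j < m := fun j => by
        have : f j = m ↔ j = i := by rw [← hi]; exact hf.1.eq_iff
        omega
      let S : Finset (Fin n) := {j | f j < m}
      let Q : Finset (Fin n × ℕ) := S ×ˢ range a
      have hinj : Set.InjOn (fun p : Fin n × ℕ => x p.1 + p.2) Q := by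
        rintro ⟨j, s⟩ hj ⟨k, t⟩ hk h
        simp only [Q, S, coe_product, Set.mem_prod, mem_coe, mem_filter, mem_univ,
          true_and] at hj hk h
        rcases eq_or_ne j k with rfl | hjk
        · simpa using h
        · exact absurd (by push_cast; linarith) (hgen j k hj.1 hk.1 hjk (t - s))
      have hcount : ∀ y : ℝ, #{p ∈ Q.image (fun p : Fin n × ℕ => x p.1 + p.2) | p < y} =
          #{p ∈ Q | x p.1 + p.2 < y} := by
        intro y
        rw [Finset.filter_image, Finset.card_image_of_injOn]
        exact hinj.mono fun p hp => Finset.mem_of_mem_filter p hp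
      obtain ⟨b, hb⟩ := (Q.image fun p : Fin n × ℕ => x p.1 + p.2).bddAbove
      obtain ⟨y, -, hyZ, hy⟩ := exists_card_filter_lt_eq
        (Set.countable_range fun p : Fin n × ℤ => x p.1 + p.2)
        (Q.image fun p : Fin n × ℕ => x p.1 + p.2) m
        (by
          rw [Finset.card_image_of_injOn hinj, Finset.card_product, card_range, mul_comm]
          exact hf.2.2 m (hi ▸ hf.2.1 i))
        (b + 1) (fun p hp => by have := hb hp; linarith)
      rw [hcount] at hy
      have hyZ' : ∀ j (z : ℤ), y ≠ x j + z := fun j z h => hyZ ⟨(j, z), h.symm⟩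
      have hlt : ∀ j, f j < m → x j < y := by
        intro j hj
        by_contra! hc
        have h1 := hx j hj
        have : #{p ∈ Q | x p.1 + p.2 < y} ≤ #{p ∈ Q | x p.1 + p.2 < x j} :=
          Finset.card_le_card (Finset.monotone_filter_right _ fun p _ hp => hp.trans_le hc)
        rw [hy] at this
        exact absurd (this.trans_eq h1) (by omega)
      have hne : ∀ j, f j < m → j ≠ i := by rintro j hj rfl; omega
      have hset : ∀ v ≤ y, #{p ∈ ({j | f j < m + 1} : Finset (Fin n)) ×ˢ range a |
          Function.update x i y p.1 + p.2 < v} = #{p ∈ Q | x p.1 + p.2 < v} := by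
        intro v hv
        congr 1
        ext ⟨j, t⟩
        simp only [Q, S, mem_filter, mem_product, mem_univ, true_and, hiff]
        rcases eq_or_ne j i with rfl | hji
        · have : (0 : ℝ) ≤ t := t.cast_nonneg
          simp only [Function.update_self, hi, lt_irrefl, false_and, iff_false, not_and, not_lt]
          intro _
          linarith
        · simp [hji]
      refine ⟨Function.update x i y, ?_, ?_⟩
      · intro j k hj hk hjk z
        rw [hiff] at hj hk
        rcases eq_or_ne j i with rfl | hji
        · rw [Function.update_self, Function.update_of_ne hjk.symm]
          intro h
          exact hyZ' k z (by linarith)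
        rcases eq_or_ne k i with rfl | hki
        · rw [Function.update_self, Function.update_of_ne hji]
          intro h
          exact hyZ' j (-z) (by push_cast; linarith)
        · rw [Function.update_of_ne hji, Function.update_of_ne hki]
          exact hgen j k (hj.resolve_left hji) (hk.resolve_left hki) hjk z
      · intro j hj
        rw [hiff] at hj
        rcases hj with rfl | hj
        · rw [Function.update_self, hset y le_rfl, hy, hi]
        · rw [Function.update_of_ne (hne j hj), hset _ (hlt j hj).le]
          exact hx j hj
  obtain ⟨x, h1, h2⟩ := key (a * n + 1)
  have hall : ∀ i, f i < a * n + 1 := fun i => Nat.lt_succ_of_le (hf.2.1 i)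
  refine ⟨x, fun i j => h1 i j (hall i) (hall j), fun i => ?_⟩
  simpa [hall] using h2 i (hall i)

/-- The weight function of the region containing the point `x`. -/
noncomputable def pointWeight {n : ℕ} (a : ℕ) (x : Fin n → ℝ) (i j : Fin n) : WithBot ℤ :=
  if i = j ∨ ⌊x i - x j⌋ < 1 - (a : ℤ) then ⊥
  else ((min ((a : ℤ) - 1) ⌊x i - x j⌋ : ℤ) : WithBot ℤ)

theorem floor_sub_swap {u v : ℝ} (h : ∀ z : ℤ, u - v ≠ z) : ⌊v - u⌋ = -1 - ⌊u - v⌋ := by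
  rw [Int.floor_eq_iff]
  have h1 := Int.floor_le (u - v)
  have h2 := Int.lt_floor_add_one (u - v)
  have h3 := lt_of_le_of_ne h1 (h _).symm
  push_cast
  constructor <;> linarith

theorem validW_pointWeight {n a : ℕ} (ha : 1 ≤ a) {x : Fin n → ℝ}
    (hx : ∀ i j, i ≠ j → ∀ z : ℤ, x i - x j ≠ z) :
    ValidW (fun _ _ => 1 - (a : ℤ)) (fun _ _ => (a : ℤ) - 1) (pointWeight a x) := by
  refine ⟨fun i => by simp [pointWeight], fun i j hij => ?_⟩
  have hswap := floor_sub_swap (hx i j hij)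
  simp only [pointWeight, hij, hij.symm, false_or, hswap]
  refine ⟨?_, ?_, ?_⟩
  · split_ifs with h
    · simp
    · intro _
      simp only [WithBot.coe_le_coe]
      omega
  · split_ifs with h h' h'
    · omega
    · simp only [WithBot.coe_inj, true_iff]
      omega
    · simp
    · simp only [WithBot.coe_inj, WithBot.coe_ne_bot, false_iff]
      omega
  · intro u v hu hv
    split_ifs at hu hv with h h'
    all_goals simp only [WithBot.coe_inj, WithBot.bot_ne_coe] at hu hv
    omega

theorem mAcyclic_pointWeight {n a : ℕ} {x : Fin n → ℝ}
    (hx : ∀ i j, i ≠ j → ∀ z : ℤ, x i - x j ≠ z) : MAcyclic (pointWeight a x) := by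
  rintro c ⟨⟨hlen, -, hfin⟩, hsum⟩
  have hpair : ∀ p : Fin n × Fin n, pointWeight a x p.1 p.2 ≠ ⊥ →
      ∃ z : ℤ, pointWeight a x p.1 p.2 = z ∧ (z : ℝ) < x p.1 - x p.2 := by
    rintro ⟨i, j⟩ h
    unfold pointWeight at h ⊢
    split_ifs at h ⊢ with hb
    · exact absurd rfl h
    push Not at hb
    refine ⟨_, rfl, lt_of_le_of_lt (Int.cast_le.2 (min_le_right _ _)) ?_⟩
    exact lt_of_le_of_ne (Int.floor_le _) (hx i j hb.1 _).symm
  choose! z hz hzlt using hpair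
  have hw : cycWeight (pointWeight a x) c = (((cpairs c).map z).sum : ℤ) := by
    unfold cycWeight
    rw [List.map_congr_left fun p hp => hz p (hfin p hp)]
    induction cpairs c with
    | nil => rfl
    | cons p l ih => simp [ih]
  have hne : cpairs c ≠ [] := by
    rw [← List.length_pos_iff]
    simp [cpairs]
    omega
  have hlt : ((cpairs c).map fun p => (z p : ℝ)).sum <
      ((cpairs c).map fun p => x p.1 - x p.2).sum :=
    List.sum_lt_sum_of_ne_nil hne _ _ fun p hp => hzlt p (hfin p hp)
  have htel : ((cpairs c).map fun p => x p.1 - x p.2).sum = 0 := by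
    have h1 : (cpairs c).map (fun p => x p.1) = c.map x := by
      rw [← Function.comp_def x, ← List.map_map, cpairs, List.map_fst_zip (by simp)]
    have h2 : (cpairs c).map (fun p => x p.2) = (c.rotate 1).map x := by
      rw [← Function.comp_def x, ← List.map_map, cpairs, List.map_snd_zip (by simp)]
    have h3 := (((c.rotate_perm 1).map x).sum_eq)
    rw [← Multiset.sum_coe, ← Multiset.map_coe, Multiset.sum_map_sub, Multiset.map_coe,
      Multiset.map_coe, h1, h2, Multiset.sum_coe, Multiset.sum_coe, h3, sub_self]
  rw [hw] at hsum
  have h0 : 0 ≤ ((cpairs c).map z).sum := by exact_mod_cast hsum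
  have h0' : (0 : ℝ) ≤ (((cpairs c).map z).sum : ℤ) := by exact_mod_cast h0
  rw [Int.cast_list_sum, List.map_map] at h0'
  simp only [Function.comp_def] at h0'
  linarith

theorem rankBelow_pointWeight {n a : ℕ} (ha : 1 ≤ a) {x : Fin n → ℝ}
    (hx : ∀ i j, i ≠ j → ∀ z : ℤ, x i - x j ≠ z) (i : Fin n) :
    rankBelow (intWeight a (pointWeight a x)) i =
      #{p ∈ (univ : Finset (Fin n)) ×ˢ range a | x p.1 + p.2 < x i} := by
  rw [Finset.card_filter, Finset.sum_product]
  refine Finset.sum_congr rfl fun j _ => ?_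
  rw [← Finset.card_filter]
  have hset : ({t ∈ range a | x j + (t : ℕ) < x i} : Finset ℕ) =
      range (intWeight a (pointWeight a x) i j + 1).toNat := by
    ext t
    simp only [mem_filter, mem_range]
    have hiff : x j + (t : ℝ) < x i ↔ i ≠ j ∧ (t : ℤ) ≤ ⌊x i - x j⌋ := by
      rw [Int.le_floor]
      push_cast
      constructor
      · intro h
        refine ⟨?_, by linarith⟩
        rintro rfl
        have : (0 : ℝ) ≤ t := t.cast_nonneg
        linarith
      · rintro ⟨hij, h⟩
        have := lt_of_le_of_ne h fun h => hx i j hij t (by push_cast; exact h.symm)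
        linarith
    rw [hiff]
    unfold intWeight pointWeight
    split_ifs with h
    · simp only [WithBot.unbotD_bot]
      omega
    · simp only [WithBot.unbotD_coe]
      omega
  rw [hset, card_range]

theorem intWeight_injOn {n a : ℕ} : Set.InjOn (intWeight (n := n) a)
    {w | ValidW (fun _ _ => 1 - (a : ℤ)) (fun _ _ => (a : ℤ) - 1) w} := by
  have hne : ∀ w : Fin n → Fin n → WithBot ℤ,
      ValidW (fun _ _ => 1 - (a : ℤ)) (fun _ _ => (a : ℤ) - 1) w → ∀ i j (x : ℤ),
      w i j = x → x ≠ -a := by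
    intro w hw i j x hx
    rcases eq_or_ne i j with rfl | hij
    · rw [hw.1] at hx
      exact absurd hx WithBot.bot_ne_coe
    · have h := (hw.2 i j hij).1
      rw [hx] at h
      have h1 := (h WithBot.coe_ne_bot).1
      simp only [WithBot.coe_le_coe] at h1
      omega
  intro w hw w' hw' h
  funext i j
  have hij := congrFun (congrFun h i) j
  have h1 := hne w hw i j
  have h2 := hne w' hw' i j
  unfold intWeight at hij
  cases hx : w i j with
  | bot =>
    cases hy : w' i j with
    | bot => rfl
    | coe y =>
      rw [hx, hy] at hij
      exact absurd hij.symm (h2 y hy)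
  | coe x =>
    cases hy : w' i j with
    | bot =>
      rw [hx, hy] at hij
      exact absurd hij (h1 x hx)
    | coe y =>
      rw [hx, hy] at hij
      exact congrArg _ hij

theorem bijOn_rankBelow {n a : ℕ} (ha : 1 ≤ a) :
    Set.BijOn (fun w : Fin n → Fin n → WithBot ℤ => rankBelow (intWeight a w))
      {w | ValidW (fun _ _ => 1 - (a : ℤ)) (fun _ _ => (a : ℤ) - 1) w ∧ MAcyclic w}
      (BallotFunctions n a) := by
  refine ⟨?_, ?_, ?_⟩
  · rintro w ⟨hv, hw⟩
    have h := isTriangular_intWeight ha hv hw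
    exact mem_ballotFunctions h.rankBelow_injective (h.rankBelow_le ha)
  · rintro w ⟨hv, hw⟩ w' ⟨hv', hw'⟩ h
    exact intWeight_injOn hv hv' ((isTriangular_intWeight ha hv hw).eq_of_rankBelow_eq
      (isTriangular_intWeight ha hv' hw') ha h)
  · intro f hf
    obtain ⟨x, hx, hxf⟩ := exists_point_of_mem_ballotFunctions hf
    exact ⟨pointWeight a x, ⟨validW_pointWeight ha hx, mAcyclic_pointWeight hx⟩,
      funext fun i => (rankBelow_pointWeight ha hx i).trans (hxf i)⟩

theorem stmt18 (n a : ℕ) (hn : 1 ≤ n) (ha : 1 ≤ a) :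
    Set.ncard {w : Fin n → Fin n → WithBot ℤ |
        ValidW (fun _ _ => 1 - (a : ℤ)) (fun _ _ => (a : ℤ) - 1) w ∧ MAcyclic w}
      = (a * n).factorial / ((a - 1) * n + 1).factorial := by
  rw [← ncard_ballotFunctions ha, ← (bijOn_rankBelow ha).image_eq,
    (bijOn_rankBelow ha).injOn.ncard_image]
end
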